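/- Let N be a positive integer, let a be an integer with 1 ≤ a ≤ N, and let r be a real number. Then there exists ε > 0 such that for all real u, v, w with |u|, |v|, |w| < ε, all complex numbers α₁, α₂, β₁, β₂ satisfying α₁+α₂ = u+vr, α₁α₂ = r(uv−w²), β₁+β₂ = −u+v(1−r), β₁β₂ = (r−1)(uv−w²), and all real z with 0 < z < 1, one has Φ₀^r(u,v,w;z) = (z^a/((a−α₁)(a−α₂))) · ₃F₂((a+β₁)/N, (a+β₂)/N, 1; (a−α₁)/N + 1, (a−α₂)/N + 1; z^N). -/

import Mathlib

/-- All groupings of an index obtained by replacing each box in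
`k₁ □ k₂ □ ⋯ □ kₙ` by a comma (new block) or a plus (merge). -/
def groupings : List ℕ → List (List ℕ)
  | [] => [[]]
  | [x] => [[x]]
  | x :: y :: rest => ((groupings (y :: rest)).map (x :: ·)) ++ groupings ((x + y) :: rest)
termination_by l => l.length

/-- The one-variable function
`L_{N,a}(k; z) = Σ_{m₁ > ⋯ > mₙ > 0, mᵢ ≡ a (mod N)} z^{m₁}/(m₁^{k₁} ⋯ mₙ^{kₙ})`. -/
noncomputable def Lv (N a : ℕ) (k : List ℕ) (z : ℝ) : ℝ :=
  ∑' m : {f : Fin k.length → ℕ // StrictAnti f ∧ ∀ i, 0 < f i ∧ f i % N = a % N},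
    (if h : 0 < k.length then z ^ (m.1 ⟨0, h⟩) else 1) *
      ∏ i : Fin k.length, ((m.1 i : ℝ) ^ k.get i)⁻¹

/-- The interpolated function `L^r_{N,a}(k; z) = Σ_p r^{n - dep(p)} L_{N,a}(p; z)`
over all groupings `p` of `k`. -/
noncomputable def iLv (N a : ℕ) (r : ℝ) (k : List ℕ) (z : ℝ) : ℝ :=
  ((groupings k).map (fun p => r ^ (k.length - p.length) * Lv N a p z)).sum

/-- An index is admissible if all entries are positive and the first entry is at least `2`. -/
def IsAdmissible (k : List ℕ) : Prop := (∀ i ∈ k, 1 ≤ i) ∧ 2 ≤ k.headI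

/-- The height of an index: the number of entries that are at least `2`. -/
def height (k : List ℕ) : ℕ := k.countP (fun i => 2 ≤ i)

/-- `X₀^r(k,n,s;z)`: sum of `L^r_{N,a}(k;z)` over all admissible indices of
weight `k`, depth `n` and height `s`. -/
noncomputable def X0z (N a : ℕ) (r : ℝ) (k n s : ℕ) (z : ℝ) : ℝ :=
  ∑' l : {l : List ℕ // IsAdmissible l ∧ l.sum = k ∧ l.length = n ∧ height l = s},
    iLv N a r l.1 z

/-- `X^r(k,n,s;z)`: sum of `L^r_{N,a}(k;z)` over all indices of
weight `k`, depth `n` and height `s`. -/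
noncomputable def Xz (N a : ℕ) (r : ℝ) (k n s : ℕ) (z : ℝ) : ℝ :=
  ∑' l : {l : List ℕ // (∀ i ∈ l, 1 ≤ i) ∧ l.sum = k ∧ l.length = n ∧ height l = s},
    iLv N a r l.1 z

/-- The generating function
`Φ₀^r(u,v,w;z) = Σ_{k,n,s} X₀^r(k,n,s;z) u^{k-n-s} v^{n-s} w^{2s-2}`
(the only nonzero contributions have `k ≥ n+s` and `n ≥ s ≥ 1`). -/
noncomputable def Phi0 (N a : ℕ) (r u v w : ℝ) (z : ℝ) : ℝ :=
  ∑' p : ℕ × ℕ × ℕ,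
    if p.2.1 + p.2.2 ≤ p.1 ∧ p.2.2 ≤ p.2.1 ∧ 1 ≤ p.2.2 then
      X0z N a r p.1 p.2.1 p.2.2 z * u ^ (p.1 - p.2.1 - p.2.2) * v ^ (p.2.1 - p.2.2)
        * w ^ (2 * p.2.2 - 2)
    else 0

/-- Rising factorial (Pochhammer symbol) `(b)ₙ = b(b+1)⋯(b+n-1)`. -/
noncomputable def poch {K : Type*} [RCLike K] (b : K) (n : ℕ) : K :=
  ∏ i ∈ Finset.range n, (b + i)

/-- The generalized hypergeometric function
`F(b; c; z) = Σ_{n≥0} (b₁)ₙ⋯(bₚ)ₙ/((c₁)ₙ⋯(c_q)ₙ) · zⁿ/n!`. -/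
noncomputable def genHyp {K : Type*} [RCLike K] (b c : List K) (z : K) : K :=
  ∑' n : ℕ, ((b.map fun x => poch x n).prod / (c.map fun x => poch x n).prod)
    * z ^ n / (n.factorial : K)


lemma strictAnti_cons_iff {n : ℕ} (m : ℕ) (f : Fin n → ℕ) :
    StrictAnti (Fin.cons m f : Fin (n + 1) → ℕ) ↔ (∀ i, f i < m) ∧ StrictAnti f :=
  Fin.liftFun_cons (α := ℕ) (· > ·)

lemma HasSum.of_eq {ι α : Type*} [AddCommMonoid α] [TopologicalSpace α] {f g : ι → α} {a b : α}
    (h : HasSum f a) (hfg : ∀ i, g i = f i) (hab : b = a) : HasSum g b := by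
  rwa [funext hfg, hab]

/-- If `f` is nonnegative with summable rows and summable row sums, then it has the iterated sum. -/
lemma hasSum_prod_of_nonneg {ι κ : Type*} {f : ι × κ → ℝ} {g : ι → ℝ} (hf : ∀ p, 0 ≤ f p)
    (hrow : ∀ i, HasSum (fun k => f (i, k)) (g i)) (hg : Summable g) :
    HasSum f (∑' i, g i) := by
  have hs : Summable f := by
    rw [summable_prod_of_nonneg hf]
    refine ⟨fun i => (hrow i).summable, ?_⟩
    simpa only [(hrow _).tsum_eq] using hg
  have := hs.hasSum.prod_fiberwise hrow
  rw [this.tsum_eq]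
  exact hs.hasSum

/-- The indicator of the positive integers congruent to `a` modulo `N`. -/
noncomputable def residueInd (N a m : ℕ) : ℝ := if 0 < m ∧ m % N = a % N then 1 else 0

lemma residueInd_nonneg (N a m : ℕ) : 0 ≤ residueInd N a m := by
  unfold residueInd; split_ifs <;> norm_num

lemma residueInd_le_one (N a m : ℕ) : residueInd N a m ≤ 1 := by
  unfold residueInd; split_ifs <;> norm_num

/-- The truncated sum `Σ_{M > m₁ > ⋯ > mₙ} ∏ c(mᵢ) mᵢ^{-kᵢ}`. -/
noncomputable def strictSum (c : ℕ → ℝ) : List ℕ → ℕ → ℝ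
  | [], _ => 1
  | x :: t, M => ∑ m ∈ Finset.range M, c m * ((m : ℝ) ^ x)⁻¹ * strictSum c t m

lemma strictSum_nonneg {c : ℕ → ℝ} (hc : ∀ m, 0 ≤ c m) (t : List ℕ) (M : ℕ) :
    0 ≤ strictSum c t M := by
  induction t generalizing M with
  | nil => simp [strictSum]
  | cons x t ih =>
    exact Finset.sum_nonneg fun m _ =>
      mul_nonneg (mul_nonneg (hc m) (by positivity)) (ih m)

lemma inv_natCast_pow_le_one (m x : ℕ) : ((m : ℝ) ^ x)⁻¹ ≤ 1 := by
  rcases m.eq_zero_or_pos with rfl | hm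
  · rcases x.eq_zero_or_pos with rfl | hx
    · simp
    · simp [hx.ne']
  · exact inv_le_one_of_one_le₀ (one_le_pow₀ (by exact_mod_cast hm))

lemma strictSum_le {c : ℕ → ℝ} (hc : ∀ m, 0 ≤ c m) (hc1 : ∀ m, c m ≤ 1) (t : List ℕ) (M : ℕ) :
    strictSum c t M ≤ (M : ℝ) ^ t.length := by
  induction t generalizing M with
  | nil => simp [strictSum]
  | cons x t ih =>
    calc strictSum c (x :: t) M
        ≤ ∑ _m ∈ Finset.range M, (M : ℝ) ^ t.length := by
          refine Finset.sum_le_sum fun m hm => ?_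
          have hm' : (m : ℝ) ≤ M := by exact_mod_cast (Finset.mem_range.1 hm).le
          calc c m * ((m : ℝ) ^ x)⁻¹ * strictSum c t m ≤ 1 * 1 * strictSum c t m := by
                gcongr
                · exact strictSum_nonneg hc t m
                · exact hc1 m
                · exact inv_natCast_pow_le_one m x
            _ ≤ (m : ℝ) ^ t.length := by simpa using ih m
            _ ≤ (M : ℝ) ^ t.length := by gcongr
      _ = (M : ℝ) ^ (x :: t).length := by simp [pow_succ']

/-- The admissible summation points of the nested sums. -/
def IsSummationChain (N a : ℕ) {n : ℕ} (f : Fin n → ℕ) : Prop :=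
  StrictAnti f ∧ ∀ i, 0 < f i ∧ f i % N = a % N

lemma isSummationChain_cons_iff (N a : ℕ) {n : ℕ} (m : ℕ) (f : Fin n → ℕ) :
    IsSummationChain N a (Fin.cons m f : Fin (n + 1) → ℕ) ↔
      (0 < m ∧ m % N = a % N) ∧ IsSummationChain N a f ∧ ∀ i, f i < m := by
  simp only [IsSummationChain, strictAnti_cons_iff, Fin.forall_fin_succ, Fin.cons_zero, Fin.cons_succ]
  tauto

open Classical in
lemma hasSum_chain_cons (N a x : ℕ) (t : List ℕ) {b : ℕ → ℝ} (hb : ∀ m, 0 ≤ b m)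
    (ht : ∀ M, HasSum (fun f : Fin t.length → ℕ =>
      if IsSummationChain N a f ∧ ∀ i, f i < M then ∏ i, ((f i : ℝ) ^ t.get i)⁻¹ else 0)
      (strictSum (residueInd N a) t M))
    (hs : Summable fun m : ℕ =>
      b m * (residueInd N a m * ((m : ℝ) ^ x)⁻¹ * strictSum (residueInd N a) t m)) :
    HasSum (fun f : Fin (t.length + 1) → ℕ =>
      if IsSummationChain N a f then b (f 0) * ∏ i, ((f i : ℝ) ^ (x :: t).get i)⁻¹ else 0)
      (∑' m : ℕ, b m * (residueInd N a m * ((m : ℝ) ^ x)⁻¹ * strictSum (residueInd N a) t m)) := by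
  rw [← (Fin.consEquiv fun _ : Fin (t.length + 1) => ℕ).hasSum_iff]
  refine hasSum_prod_of_nonneg ?_ ?_ hs
  · intro p
    simp only [Function.comp_apply]
    split_ifs
    · exact mul_nonneg (hb _) (Finset.prod_nonneg fun i _ => by positivity)
    · exact le_rfl
  · intro m
    refine ((ht m).mul_left (b m * (residueInd N a m * ((m : ℝ) ^ x)⁻¹))).of_eq (fun f => ?_) ?_
    · change (if IsSummationChain N a (Fin.cons m f : Fin (t.length + 1) → ℕ) then
        b ((Fin.cons m f : Fin (t.length + 1) → ℕ) 0) *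
          ∏ i, (((Fin.cons m f : Fin (t.length + 1) → ℕ) i : ℝ) ^ (x :: t).get i)⁻¹ else 0) = _
      rw [Fin.prod_univ_succ]
      simp only [isSummationChain_cons_iff, Fin.cons_zero, Fin.cons_succ, List.get_cons_zero,
        List.get_cons_succ', residueInd]
      split_ifs <;> first | tauto | ring
    · ring

open Classical in
lemma hasSum_strictSum (N a : ℕ) (k : List ℕ) (M : ℕ) :
    HasSum (fun f : Fin k.length → ℕ =>
      if IsSummationChain N a f ∧ ∀ i, f i < M then ∏ i, ((f i : ℝ) ^ k.get i)⁻¹ else 0)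
      (strictSum (residueInd N a) k M) := by
  induction k generalizing M with
  | nil =>
    simp only [strictSum]
    refine (hasSum_unique (β := Fin 0 → ℕ) (α := ℝ) _).of_eq (fun _ => rfl) ?_
    simp [IsSummationChain, StrictAnti]
  | cons x t ih =>
    have hz : ∀ m ∉ Finset.range M, (if m < M then (1 : ℝ) else 0) *
        (residueInd N a m * ((m : ℝ) ^ x)⁻¹ * strictSum (residueInd N a) t m) = 0 := by
      intro m hm
      rw [if_neg (by simpa using hm), zero_mul]
    refine (hasSum_chain_cons N a x t (b := fun m => if m < M then 1 else 0)
      (fun m => by positivity) ih (summable_of_ne_finset_zero hz)).of_eq (fun f => ?_) ?_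
    · have : (IsSummationChain N a f ∧ ∀ i, f i < M) ↔ IsSummationChain N a f ∧ f 0 < M :=
        and_congr_right fun h => ⟨fun h' => h' 0, fun h' i =>
          (h.1.antitone (Fin.zero_le i)).trans_lt h'⟩
      simp only [List.length_cons] at this ⊢
      simp only [this]
      split_ifs <;> first | tauto | simp
    · rw [tsum_eq_sum hz, strictSum]
      refine Finset.sum_congr rfl fun m hm => ?_
      rw [if_pos (Finset.mem_range.1 hm), one_mul]

/-- The coefficient of `z ^ m` in `L_{N,a}(k; z)` for nonempty `k`. -/
noncomputable def topCoeff (c : ℕ → ℝ) : List ℕ → ℕ → ℝ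
  | [], _ => 0
  | x :: t, m => c m * ((m : ℝ) ^ x)⁻¹ * strictSum c t m

lemma summable_topCoeff (N a : ℕ) (k : List ℕ) {z : ℝ} (hz : 0 < z) (hz1 : z < 1) :
    Summable fun m : ℕ => z ^ m * topCoeff (residueInd N a) k m := by
  cases k with
  | nil => simp [topCoeff, summable_zero]
  | cons x t =>
    refine Summable.of_norm_bounded (summable_pow_mul_geometric_of_norm_lt_one t.length
      (r := z) (by rwa [Real.norm_of_nonneg hz.le])) fun m => ?_
    have h0 := strictSum_nonneg (residueInd_nonneg N a) t m
    have h1 := residueInd_nonneg N a m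
    rw [topCoeff, Real.norm_of_nonneg (by positivity), mul_comm]
    gcongr
    calc residueInd N a m * ((m : ℝ) ^ x)⁻¹ * strictSum (residueInd N a) t m
        ≤ 1 * 1 * strictSum (residueInd N a) t m := by
          gcongr
          · exact residueInd_le_one N a m
          · exact inv_natCast_pow_le_one m x
      _ ≤ _ := by simpa using strictSum_le (residueInd_nonneg N a) (residueInd_le_one N a) t m

lemma hasSum_Lv (N a : ℕ) {k : List ℕ} (hk : k ≠ []) {z : ℝ} (hz : 0 < z) (hz1 : z < 1) :
    HasSum (fun m : ℕ => z ^ m * topCoeff (residueInd N a) k m) (Lv N a k z) := by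
  classical
  cases k with
  | nil => exact absurd rfl hk
  | cons x t =>
    have hs := summable_topCoeff N a (x :: t) hz hz1
    have := hasSum_chain_cons N a x t (fun m => pow_nonneg hz.le m)
      (hasSum_strictSum N a t) hs
    convert hs.hasSum using 1
    refine Eq.trans ?_ this.tsum_eq
    rw [Lv]
    have h := tsum_subtype {f : Fin (t.length + 1) → ℕ | IsSummationChain N a f}
      (fun f => z ^ (f 0) * ∏ i, ((f i : ℝ) ^ (x :: t).get i)⁻¹)
    refine Eq.trans ?_ (h.trans ?_)
    · rfl
    · exact tsum_congr fun f => by simp only [Set.indicator_apply, Set.mem_ofPred_eq]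

lemma groupings_cons_cons (x y : ℕ) (t : List ℕ) :
    groupings (x :: y :: t) =
      ((groupings (y :: t)).map (x :: ·)) ++ groupings ((x + y) :: t) := by
  rw [groupings]

lemma length_le_and_ne_nil_of_mem_groupings (x : ℕ) (t : List ℕ) :
    ∀ p ∈ groupings (x :: t), p.length ≤ t.length + 1 ∧ p ≠ [] := by
  induction t generalizing x with
  | nil => simp [groupings]
  | cons y t ih =>
    intro p hp
    rw [groupings_cons_cons, List.mem_append, List.mem_map] at hp
    rcases hp with ⟨p', hp', rfl⟩ | hp
    · have := (ih y p' hp').1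
      simp only [List.length_cons]
      exact ⟨by omega, by simp⟩
    · have := ih (x + y) p hp
      simp only [List.length_cons]
      exact ⟨by omega, this.2⟩

/-- The interpolated combination `Σ_p r^{dep(k) - dep(p)} f(p)` over the groupings `p` of `k`. -/
noncomputable def groupingSum (r : ℝ) (f : List ℕ → ℝ) (k : List ℕ) : ℝ :=
  ((groupings k).map fun p => r ^ (k.length - p.length) * f p).sum

lemma groupingSum_singleton (r : ℝ) (f : List ℕ → ℝ) (x : ℕ) :
    groupingSum r f [x] = f [x] := by
  simp [groupingSum, groupings]

lemma groupingSum_cons_cons (r : ℝ) (f : List ℕ → ℝ) (x y : ℕ) (t : List ℕ) :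
    groupingSum r f (x :: y :: t) =
      groupingSum r (fun p => f (x :: p)) (y :: t) + r * groupingSum r f ((x + y) :: t) := by
  simp only [groupingSum, groupings_cons_cons, List.map_append, List.sum_append, List.map_map]
  congr 1
  · congr 1
    refine List.map_congr_left fun p _ => ?_
    simp [Function.comp]
  · rw [← List.sum_map_mul_left]
    congr 1
    refine List.map_congr_left fun p hp => ?_
    have := (length_le_and_ne_nil_of_mem_groupings _ _ p hp).1
    have h : (x :: y :: t).length - p.length = ((x + y) :: t).length - p.length + 1 := by
      simp only [List.length_cons]; omega
    rw [h]
    ring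

lemma groupingSum_congr {r : ℝ} {f g : List ℕ → ℝ} {x : ℕ} {t : List ℕ}
    (h : ∀ p ≠ [], f p = g p) : groupingSum r f (x :: t) = groupingSum r g (x :: t) := by
  unfold groupingSum
  congr 1
  refine List.map_congr_left fun p hp => ?_
  rw [h p (length_le_and_ne_nil_of_mem_groupings x t p hp).2]

lemma groupingSum_const_mul (r b : ℝ) (f : List ℕ → ℝ) (k : List ℕ) :
    groupingSum r (fun p => b * f p) k = b * groupingSum r f k := by
  unfold groupingSum
  rw [← List.sum_map_mul_left]
  congr 1
  exact List.map_congr_left fun p _ => by ring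

lemma groupingSum_finset_sum {ι : Type*} (s : Finset ι) (r : ℝ) (f : ι → List ℕ → ℝ)
    (k : List ℕ) :
    groupingSum r (fun p => ∑ i ∈ s, f i p) k = ∑ i ∈ s, groupingSum r (f i) k := by
  unfold groupingSum
  induction groupings k with
  | nil => simp
  | cons p L ih =>
    simp only [List.map_cons, List.sum_cons, Finset.sum_add_distrib]
    rw [ih, Finset.mul_sum]

lemma hasSum_groupingSum {ι : Type*} {r : ℝ} {f : ι → List ℕ → ℝ} {b : List ℕ → ℝ}
    (h : ∀ p ≠ [], HasSum (fun i => f i p) (b p)) (x : ℕ) (t : List ℕ) :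
    HasSum (fun i => groupingSum r (f i) (x :: t)) (groupingSum r b (x :: t)) := by
  have key : ∀ L : List (List ℕ), (∀ p ∈ L, p ≠ []) →
      HasSum (fun i => (L.map fun p => r ^ ((x :: t).length - p.length) * f i p).sum)
        (L.map fun p => r ^ ((x :: t).length - p.length) * b p).sum := by
    intro L hL
    induction L with
    | nil => simp
    | cons p L ih =>
      simp only [List.map_cons, List.sum_cons]
      exact ((h p (hL p (by simp))).mul_left _).add (ih fun q hq => hL q (by simp [hq]))
  exact key _ fun p hp => (length_le_and_ne_nil_of_mem_groupings x t p hp).2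

/-- The interpolated truncated sum with weights `q y m` in place of `m^{-y}`: the first entries of
the index may be merged into a block at `m`, the remaining summation variables are below `m`. -/
noncomputable def interpSum (c : ℕ → ℝ) (r : ℝ) (q : ℕ → ℕ → ℝ) : List ℕ → ℕ → ℝ
  | [], _ => 1
  | y :: t, m => (∑ l ∈ Finset.range m, c l * (q y l * interpSum c r q t l)) +
      r * (q y m * interpSum c r q t m)

lemma strictSum_eq_sum_topCoeff (c : ℕ → ℝ) {p : List ℕ} (hp : p ≠ []) (M : ℕ) :
    strictSum c p M = ∑ m ∈ Finset.range M, topCoeff c p m := by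
  cases p with
  | nil => exact absurd rfl hp
  | cons x t => rfl

lemma groupingSum_topCoeff (c : ℕ → ℝ) (r : ℝ) (x : ℕ) (t : List ℕ) (m : ℕ) :
    groupingSum r (fun p => topCoeff c p m) (x :: t) =
      c m * ((m : ℝ) ^ x)⁻¹ * interpSum c r (fun y l => ((l : ℝ) ^ y)⁻¹) t m := by
  induction t generalizing x m with
  | nil => simp [groupingSum_singleton, topCoeff, strictSum, interpSum]
  | cons y t ih =>
    rw [groupingSum_cons_cons, ih]
    have : groupingSum r (fun p => topCoeff c (x :: p) m) (y :: t) =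
        groupingSum r (fun p => c m * ((m : ℝ) ^ x)⁻¹ *
          ∑ l ∈ Finset.range m, topCoeff c p l) (y :: t) :=
      groupingSum_congr fun p hp => by rw [topCoeff, strictSum_eq_sum_topCoeff c hp]
    rw [this, groupingSum_const_mul, groupingSum_finset_sum]
    simp only [ih, interpSum, pow_add, mul_inv]
    rw [mul_add]
    congr 1
    · simp only [mul_assoc]
    · ring

lemma hasSum_iLv (N a : ℕ) (r : ℝ) (x : ℕ) (t : List ℕ) {z : ℝ} (hz : 0 < z) (hz1 : z < 1) :
    HasSum (fun m : ℕ => z ^ m * (residueInd N a m * ((m : ℝ) ^ x)⁻¹ *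
      interpSum (residueInd N a) r (fun y l => ((l : ℝ) ^ y)⁻¹) t m))
      (iLv N a r (x :: t) z) := by
  refine (hasSum_groupingSum (r := r)
    (fun p hp => hasSum_Lv N a hp hz hz1) x t).of_eq (fun m => ?_) rfl
  rw [groupingSum_const_mul, groupingSum_topCoeff]

/-- The interpolated sum of an index weighted entrywise. -/
lemma interpSum_mul_prod (c : ℕ → ℝ) (r : ℝ) (q : ℕ → ℕ → ℝ) (ω : ℕ → ℝ) (t : List ℕ) (m : ℕ) :
    interpSum c r q t m * (t.map ω).prod = interpSum c r (fun y l => ω y * q y l) t m := by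
  induction t generalizing m with
  | nil => simp [interpSum]
  | cons y t ih =>
    simp only [interpSum, List.map_cons, List.prod_cons, ← ih, add_mul, Finset.sum_mul]
    congr 1
    · exact Finset.sum_congr rfl fun l _ => by ring
    · ring

lemma interpSum_nonneg {c : ℕ → ℝ} {r : ℝ} {q : ℕ → ℕ → ℝ} (hc : ∀ m, 0 ≤ c m) (hr : 0 ≤ r)
    (hq : ∀ y m, 0 ≤ q y m) (t : List ℕ) (m : ℕ) : 0 ≤ interpSum c r q t m := by
  induction t generalizing m with
  | nil => simp [interpSum]
  | cons y t ih =>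
    exact add_nonneg (Finset.sum_nonneg fun l _ => mul_nonneg (hc l) (mul_nonneg (hq y l) (ih l)))
      (mul_nonneg hr (mul_nonneg (hq y m) (ih m)))

lemma abs_interpSum_le {c : ℕ → ℝ} (r : ℝ) (q : ℕ → ℕ → ℝ) (hc : ∀ m, 0 ≤ c m)
    (t : List ℕ) (m : ℕ) :
    |interpSum c r q t m| ≤ interpSum c |r| (fun y l => |q y l|) t m := by
  induction t generalizing m with
  | nil => simp [interpSum]
  | cons y t ih =>
    refine (abs_add_le _ _).trans (add_le_add ((Finset.abs_sum_le_sum_abs _ _).trans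
      (Finset.sum_le_sum fun l _ => ?_)) ?_)
    · rw [abs_mul, abs_mul, abs_of_nonneg (hc l)]
      have := hc l
      gcongr
      exact ih l
    · rw [abs_mul, abs_mul]
      gcongr
      exact ih m

/-- The closed form of the sum of `interpSum c r q t m` over all `t`, in terms of the row sums `g`
of `q`. -/
noncomputable def blockProd (c : ℕ → ℝ) (r : ℝ) (g : ℕ → ℝ) (m : ℕ) : ℝ :=
  (∏ l ∈ Finset.range m, (1 + c l * (g l / (1 - r * g l)))) / (1 - r * g m)

lemma prod_range_eq_one_add_sum_blockProd (c : ℕ → ℝ) (r : ℝ) (g : ℕ → ℝ) (m : ℕ) :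
    ∏ l ∈ Finset.range m, (1 + c l * (g l / (1 - r * g l))) =
      1 + ∑ l ∈ Finset.range m, c l * (g l * blockProd c r g l) := by
  induction m with
  | zero => simp
  | succ m ih =>
    rw [Finset.prod_range_succ, Finset.sum_range_succ, ← add_assoc, ← ih, blockProd]
    ring

lemma blockProd_fixed (c : ℕ → ℝ) (r : ℝ) (g : ℕ → ℝ) (m : ℕ) (h : 1 - r * g m ≠ 0) :
    blockProd c r g m = 1 + ((∑ l ∈ Finset.range m, c l * (g l * blockProd c r g l)) +
      r * (g m * blockProd c r g m)) := by
  have h1 : blockProd c r g m * (1 - r * g m) =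
      1 + ∑ l ∈ Finset.range m, c l * (g l * blockProd c r g l) := by
    rw [← prod_range_eq_one_add_sum_blockProd, blockProd, div_mul_cancel₀ _ h]
  linear_combination h1

lemma blockProd_nonneg {c : ℕ → ℝ} {r : ℝ} {g : ℕ → ℝ} (hc : ∀ m, 0 ≤ c m) (hg : ∀ m, 0 ≤ g m)
    (h : ∀ m, r * g m < 1) (m : ℕ) : 0 ≤ blockProd c r g m := by
  have h' : ∀ l, 0 ≤ 1 - r * g l := fun l => by linarith [h l]
  refine div_nonneg (Finset.prod_nonneg fun l _ => ?_) (h' m)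
  have := mul_nonneg (hc l) (div_nonneg (hg l) (h' l))
  linarith

/-- The lists of length at most `n` with entries below `B`. -/
def boundedLists (B : ℕ) : ℕ → Finset (List ℕ)
  | 0 => {[]}
  | n + 1 => insert [] ((Finset.range B ×ˢ boundedLists B n).image fun p => p.1 :: p.2)

lemma mem_boundedLists {B n : ℕ} {t : List ℕ} (hn : t.length ≤ n) (hB : ∀ y ∈ t, y < B) :
    t ∈ boundedLists B n := by
  induction n generalizing t with
  | zero => simpa [boundedLists] using hn
  | succ n ih =>
    cases t with
    | nil => simp [boundedLists]
    | cons y t =>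
      refine Finset.mem_insert_of_mem (Finset.mem_image.2 ⟨(y, t), Finset.mem_product.2
        ⟨Finset.mem_range.2 (hB y (by simp)), ih (by simpa using hn) fun x hx => ?_⟩, rfl⟩)
      exact hB x (by simp [hx])

lemma exists_subset_boundedLists (s : Finset (List ℕ)) : ∃ B n, s ⊆ boundedLists B n := by
  refine ⟨s.sup (fun t => t.sum) + 1, s.sup List.length, fun t ht => mem_boundedLists ?_ ?_⟩
  · exact Finset.le_sup (f := List.length) ht
  · intro y hy
    have h1 := List.single_le_sum (l := t) (fun _ _ => Nat.zero_le _) y hy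
    have h2 : t.sum ≤ s.sup (fun t => t.sum) := Finset.le_sup (f := fun t : List ℕ => t.sum) ht
    omega

lemma sum_boundedLists_succ (f : List ℕ → ℝ) (B n : ℕ) :
    ∑ t ∈ boundedLists B (n + 1), f t =
      f [] + ∑ y ∈ Finset.range B, ∑ t ∈ boundedLists B n, f (y :: t) := by
  rw [boundedLists, Finset.sum_insert (by simp), Finset.sum_image, Finset.sum_product]
  rintro ⟨x, t⟩ _ ⟨y, t'⟩ _ h
  simpa using h

lemma sum_boundedLists_interpSum_le {c : ℕ → ℝ} {r : ℝ} {q : ℕ → ℕ → ℝ} {g : ℕ → ℝ}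
    (hc : ∀ m, 0 ≤ c m) (hr : 0 ≤ r) (hq : ∀ y m, 0 ≤ q y m)
    (hg : ∀ m, HasSum (fun y => q y m) (g m)) (hrg : ∀ m, r * g m < 1) (B n m : ℕ) :
    ∑ t ∈ boundedLists B n, interpSum c r q t m ≤ blockProd c r g m := by
  have hg0 : ∀ m, 0 ≤ g m := fun m => (hg m).nonneg fun y => hq y m
  have hb0 := blockProd_nonneg hc hg0 hrg
  have hfix := fun m => blockProd_fixed c r g m (by linarith [hrg m])
  induction n generalizing m with
  | zero =>
    simp only [boundedLists, Finset.sum_singleton, interpSum]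
    rw [hfix m]
    have h1 : 0 ≤ ∑ l ∈ Finset.range m, c l * (g l * blockProd c r g l) :=
      Finset.sum_nonneg fun l _ => mul_nonneg (hc l) (mul_nonneg (hg0 l) (hb0 l))
    have h2 := mul_nonneg hr (mul_nonneg (hg0 m) (hb0 m))
    linarith
  | succ n ih =>
    have hprod : ∀ l, ∑ y ∈ Finset.range B, ∑ t ∈ boundedLists B n,
        q y l * interpSum c r q t l ≤ g l * blockProd c r g l := by
      intro l
      rw [← Finset.sum_mul_sum]
      exact mul_le_mul (sum_le_hasSum _ (fun y _ => hq y l) (hg l)) (ih l)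
        (Finset.sum_nonneg fun t _ => interpSum_nonneg hc hr hq t l) (hg0 l)
    rw [sum_boundedLists_succ, hfix m]
    simp only [interpSum, Finset.sum_add_distrib]
    refine add_le_add le_rfl (add_le_add ?_ ?_)
    · calc ∑ y ∈ Finset.range B, ∑ t ∈ boundedLists B n,
            ∑ l ∈ Finset.range m, c l * (q y l * interpSum c r q t l)
          = ∑ l ∈ Finset.range m, c l * ∑ y ∈ Finset.range B, ∑ t ∈ boundedLists B n,
            q y l * interpSum c r q t l := by
            simp only [Finset.mul_sum]
            rw [Finset.sum_comm]
            refine (Finset.sum_congr rfl fun t _ => Finset.sum_comm).trans ?_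
            rw [Finset.sum_comm]
            exact Finset.sum_congr rfl fun l _ => Finset.sum_comm
        _ ≤ _ := Finset.sum_le_sum fun l _ => mul_le_mul_of_nonneg_left (hprod l) (hc l)
    · simp only [← Finset.mul_sum]
      refine mul_le_mul_of_nonneg_left ?_ hr
      simpa only [Finset.mul_sum] using hprod m

lemma summable_interpSum_of_nonneg {c : ℕ → ℝ} {r : ℝ} {q : ℕ → ℕ → ℝ} {g : ℕ → ℝ}
    (hc : ∀ m, 0 ≤ c m) (hr : 0 ≤ r) (hq : ∀ y m, 0 ≤ q y m)
    (hg : ∀ m, HasSum (fun y => q y m) (g m)) (hrg : ∀ m, r * g m < 1) (m : ℕ) :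
    Summable fun t => interpSum c r q t m := by
  have h0 := fun t => interpSum_nonneg hc hr hq t m
  refine summable_of_sum_le (c := blockProd c r g m) h0 fun s => ?_
  obtain ⟨B, n, hs⟩ := exists_subset_boundedLists s
  exact (Finset.sum_le_sum_of_subset_of_nonneg hs fun t _ _ => h0 t).trans
    (sum_boundedLists_interpSum_le hc hr hq hg hrg B n m)

lemma tsum_list_eq {f : List ℕ → ℝ} (hf : Summable f) :
    ∑' t, f t = f [] + ∑' p : ℕ × List ℕ, f (p.1 :: p.2) := by
  classical
  have hinj : Function.Injective fun p : ℕ × List ℕ => p.1 :: p.2 := by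
    rintro ⟨x, t⟩ ⟨y, t'⟩ h
    simpa using h
  rw [hf.tsum_eq_add_tsum_ite [], ← hinj.tsum_eq]
  · simp
  · intro t ht
    cases t with
    | nil => simp at ht
    | cons x t => exact ⟨(x, t), rfl⟩

lemma hasSum_mul_of_real {ι κ : Type*} {f : ι → ℝ} {g : κ → ℝ} {s t : ℝ} (hf : HasSum f s)
    (hg : HasSum g t) : HasSum (fun p : ι × κ => f p.1 * g p.2) (s * t) :=
  hf.mul hg (summable_mul_of_summable_norm hf.summable.abs hg.summable.abs)

lemma hasSum_interpSum {c : ℕ → ℝ} {r : ℝ} {q : ℕ → ℕ → ℝ} {g G : ℕ → ℝ}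
    (hc : ∀ m, 0 ≤ c m) (hg : ∀ m, HasSum (fun y => q y m) (g m))
    (hG : ∀ m, HasSum (fun y => |q y m|) (G m)) (hrG : ∀ m, |r| * G m < 1) (m : ℕ) :
    HasSum (fun t => interpSum c r q t m) (blockProd c r g m) := by
  have habs : ∀ m, Summable fun t => |interpSum c r q t m| := fun m =>
    Summable.of_nonneg_of_le (fun _ => abs_nonneg _) (fun t => abs_interpSum_le r q hc t m)
      (summable_interpSum_of_nonneg hc (abs_nonneg r) (fun _ _ => abs_nonneg _) hG hrG m)
  have hs : ∀ m, Summable fun t => interpSum c r q t m := fun m => (habs m).of_abs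
  have hne : ∀ m, 1 - r * g m ≠ 0 := by
    intro m
    have h1 : |g m| ≤ G m := by
      rw [← (hg m).tsum_eq, ← (hG m).tsum_eq]
      exact norm_tsum_le_tsum_norm (f := fun y => q y m) (hG m).summable
    have h2 : r * g m ≤ |r| * G m :=
      (le_abs_self _).trans ((abs_mul _ _).le.trans (by gcongr))
    linarith [hrG m]
  have hprod : ∀ l, HasSum (fun p : ℕ × List ℕ => q p.1 l * interpSum c r q p.2 l)
      (g l * ∑' t, interpSum c r q t l) := fun l =>
    hasSum_mul_of_real (hg l) (hs l).hasSum
  have hrec : ∀ m, ∑' t, interpSum c r q t m =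
      1 + ((∑ l ∈ Finset.range m, c l * (g l * ∑' t, interpSum c r q t l)) +
        r * (g m * ∑' t, interpSum c r q t m)) := by
    intro m
    refine (tsum_list_eq (hs m)).trans (congrArg (1 + ·) ?_)
    exact ((hasSum_sum fun l _ => (hprod l).mul_left (c l)).add
      ((hprod m).mul_left r)).tsum_eq
  have heq : ∑' t, interpSum c r q t m = blockProd c r g m := by
    induction m using Nat.strong_induction_on with
    | _ m ih =>
      have h1 := hrec m
      have h2 := blockProd_fixed c r g m (hne m)
      rw [Finset.sum_congr rfl fun l hl => by rw [ih l (Finset.mem_range.1 hl)]] at h1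
      refine mul_left_cancel₀ (hne m) ?_
      linear_combination h1 - h2
  exact heq ▸ (hs m).hasSum

/-- The contribution of a non-leading entry of an index to the monomial in `u`, `v`, `w`. -/
def entryWeight (u v w : ℝ) : ℕ → ℝ
  | 0 => 0
  | 1 => v
  | y + 2 => u ^ y * w ^ 2

/-- The generating function of a single non-leading entry at the summation point `m`. -/
noncomputable def entrySum (u v w : ℝ) (m : ℕ) : ℝ := v / m + w ^ 2 / (m * (m - u))

lemma hasSum_head {u : ℝ} (hu : |u| < 1) (m : ℕ) :
    HasSum (fun x : ℕ => u ^ x * ((m : ℝ) ^ (x + 2))⁻¹) (1 / (m * (m - u))) := by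
  rcases m.eq_zero_or_pos with rfl | hm
  · simp
  · have hm' : (1 : ℝ) ≤ m := by exact_mod_cast hm
    have hm0 : (m : ℝ) ≠ 0 := by positivity
    have hmu : (m : ℝ) - u ≠ 0 := by linarith [le_abs_self u]
    have h1 : |u / m| < 1 := by
      rw [abs_div, Nat.abs_cast, div_lt_one (by positivity)]
      linarith
    refine ((hasSum_geometric_of_abs_lt_one h1).mul_right ((m : ℝ) ^ 2)⁻¹).of_eq (fun x => ?_) ?_
    · rw [div_pow, pow_add]
      field_simp
    · have : 1 - u / m = (m - u) / m := by field_simp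
      rw [this]
      field_simp

lemma hasSum_entry {u : ℝ} (hu : |u| < 1) (v w : ℝ) (m : ℕ) :
    HasSum (fun y => entryWeight u v w y * ((m : ℝ) ^ y)⁻¹) (entrySum u v w m) := by
  rw [← hasSum_nat_add_iff' 2]
  refine ((hasSum_head hu m).mul_right (w ^ 2)).of_eq (fun y => ?_) ?_
  · simp only [entryWeight]
    ring
  · simp only [entrySum, Finset.sum_range_succ, Finset.sum_range_zero, entryWeight]
    ring

lemma abs_entryWeight_mul (u v w : ℝ) (y m : ℕ) :
    |entryWeight u v w y * ((m : ℝ) ^ y)⁻¹| = entryWeight |u| |v| w y * ((m : ℝ) ^ y)⁻¹ := by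
  rw [abs_mul, abs_of_nonneg (a := ((m : ℝ) ^ y)⁻¹) (by positivity)]
  congr 1
  match y with
  | 0 => simp [entryWeight]
  | 1 => simp [entryWeight]
  | y + 2 => simp [entryWeight, abs_mul]

lemma entrySum_bound {r u v w : ℝ} (hr : 0 ≤ r) (hu0 : 0 ≤ u) (hv0 : 0 ≤ v)
    (hu : u < 1 / (6 * (1 + r))) (hv : v < 1 / (6 * (1 + r))) (hw : |w| < 1 / (6 * (1 + r)))
    {m : ℕ} (hm : 1 ≤ m) :
    0 ≤ entrySum u v w m ∧ (1 + r) * entrySum u v w m ≤ 1 / (2 * m) := by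
  have hm' : (1 : ℝ) ≤ m := by exact_mod_cast hm
  have he : 1 / (6 * (1 + r)) ≤ 1 / 6 := one_div_le_one_div_of_le (by norm_num) (by linarith)
  have hmu : 1 / 2 ≤ (m : ℝ) - u := by linarith
  have hw2 : w ^ 2 ≤ 1 / (6 * (1 + r)) := by
    rw [← sq_abs]
    nlinarith [abs_nonneg w]
  have h1 : entrySum u v w m ≤ 3 * (1 / (6 * (1 + r))) / m := by
    have : w ^ 2 / (m * (m - u)) ≤ 2 * w ^ 2 / m := by
      rw [div_le_div_iff₀ (by positivity) (by positivity)]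
      nlinarith [mul_nonneg (sq_nonneg w) (by positivity : (0 : ℝ) ≤ m)]
    calc entrySum u v w m ≤ v / m + 2 * w ^ 2 / m := by unfold entrySum; gcongr
      _ = (v + 2 * w ^ 2) / m := by ring
      _ ≤ _ := by gcongr; linarith
  refine ⟨?_, ?_⟩
  · unfold entrySum
    have : 0 ≤ (m : ℝ) - u := by linarith
    positivity
  · calc (1 + r) * entrySum u v w m ≤ (1 + r) * (3 * (1 / (6 * (1 + r))) / m) := by gcongr
      _ = 1 / (2 * m) := by field_simp; norm_num

lemma entrySum_zero (u v w : ℝ) : entrySum u v w 0 = 0 := by simp [entrySum]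

lemma mul_entrySum_le_half {r u v w : ℝ} (hr : 0 ≤ r) (hu0 : 0 ≤ u) (hv0 : 0 ≤ v)
    (hu : u < 1 / (6 * (1 + r))) (hv : v < 1 / (6 * (1 + r))) (hw : |w| < 1 / (6 * (1 + r)))
    (m : ℕ) : r * entrySum u v w m ≤ 1 / 2 := by
  rcases m.eq_zero_or_pos with rfl | hm
  · simp [entrySum_zero]
  · obtain ⟨h0, h1⟩ := entrySum_bound hr hu0 hv0 hu hv hw hm
    have : 1 / (2 * (m : ℝ)) ≤ 1 / 2 := by
      have hm' : (1 : ℝ) ≤ m := by exact_mod_cast hm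
      exact one_div_le_one_div_of_le (by norm_num) (by linarith)
    linarith

lemma blockProd_entrySum_le {c : ℕ → ℝ} (hc : ∀ m, 0 ≤ c m) (hc1 : ∀ m, c m ≤ 1)
    {r u v w : ℝ} (hr : 0 ≤ r) (hu0 : 0 ≤ u) (hv0 : 0 ≤ v)
    (hu : u < 1 / (6 * (1 + r))) (hv : v < 1 / (6 * (1 + r))) (hw : |w| < 1 / (6 * (1 + r)))
    (m : ℕ) : blockProd c r (entrySum u v w) m ≤ 2 * (m + 1) := by
  have hhalf := mul_entrySum_le_half hr hu0 hv0 hu hv hw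
  have hfac : ∀ l : ℕ, 1 ≤ l → 0 ≤ entrySum u v w l / (1 - r * entrySum u v w l) ∧
      entrySum u v w l / (1 - r * entrySum u v w l) ≤ 1 / l := by
    intro l hl
    obtain ⟨h0, h1⟩ := entrySum_bound hr hu0 hv0 hu hv hw hl
    have h2 := hhalf l
    refine ⟨div_nonneg h0 (by linarith), ?_⟩
    have h3 : entrySum u v w l ≤ 1 / (2 * l) := by nlinarith
    rw [div_le_iff₀ (by linarith)]
    calc entrySum u v w l ≤ 1 / (2 * l) := h3
      _ = 1 / l * (1 / 2) := by field_simp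
      _ ≤ _ := by gcongr; linarith
  have hprod : ∀ n : ℕ, 0 ≤ ∏ l ∈ Finset.range (n + 1),
        (1 + c l * (entrySum u v w l / (1 - r * entrySum u v w l))) ∧
      ∏ l ∈ Finset.range (n + 1),
        (1 + c l * (entrySum u v w l / (1 - r * entrySum u v w l))) ≤ n + 1 := by
    intro n
    induction n with
    | zero => simp [entrySum_zero]
    | succ n ih =>
      rw [Finset.prod_range_succ]
      obtain ⟨h0, h1⟩ := hfac (n + 1) (by omega)
      have h2 := mul_nonneg (hc (n + 1)) h0
      have h3 : c (n + 1) * (entrySum u v w (n + 1) / (1 - r * entrySum u v w (n + 1))) ≤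
          1 / ((n + 1 : ℕ) : ℝ) :=
        (mul_le_of_le_one_left h0 (hc1 _)).trans h1
      refine ⟨mul_nonneg ih.1 (by linarith), ?_⟩
      calc _ ≤ ((n : ℝ) + 1) * (1 + 1 / ((n + 1 : ℕ) : ℝ)) :=
            mul_le_mul ih.2 (by linarith) (by linarith) (by positivity)
        _ = ((n + 1 : ℕ) : ℝ) + 1 := by push_cast; field_simp
  have hle : ∏ l ∈ Finset.range m,
      (1 + c l * (entrySum u v w l / (1 - r * entrySum u v w l))) ≤ m + 1 := by
    cases m with
    | zero => simp
    | succ n => exact (hprod n).2.trans (by push_cast; linarith)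
  rw [blockProd, div_le_iff₀ (by linarith [hhalf m])]
  refine hle.trans ?_
  have : (0 : ℝ) ≤ m + 1 := by positivity
  nlinarith [hhalf m]

lemma hasSum_coeff_mul_index {r u v w : ℝ} {c : ℕ → ℝ} (hc : ∀ m, 0 ≤ c m)
    (hu : |u| < 1 / (6 * (1 + |r|))) (hv : |v| < 1 / (6 * (1 + |r|)))
    (hw : |w| < 1 / (6 * (1 + |r|))) (b : ℝ) (m : ℕ) :
    HasSum (fun p : ℕ × List ℕ => b * c m * ((u ^ p.1 * ((m : ℝ) ^ (p.1 + 2))⁻¹) *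
      interpSum c r (fun y l => entryWeight u v w y * ((l : ℝ) ^ y)⁻¹) p.2 m))
      (b * c m * (1 / (m * (m - u)) * blockProd c r (entrySum u v w) m)) := by
  have he : 1 / (6 * (1 + |r|)) ≤ 1 / 6 :=
    one_div_le_one_div_of_le (by norm_num) (by linarith [abs_nonneg r])
  have hu1 : |u| < 1 := by linarith
  have hG : ∀ m : ℕ, HasSum (fun y => |entryWeight u v w y * ((m : ℝ) ^ y)⁻¹|)
      (entrySum |u| |v| w m) := fun m => by
    simpa only [abs_entryWeight_mul] using hasSum_entry (by rwa [abs_abs]) |v| w m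
  have hrG : ∀ m, |r| * entrySum |u| |v| w m < 1 := fun m => by
    linarith [mul_entrySum_le_half (abs_nonneg r) (abs_nonneg u) (abs_nonneg v) hu hv hw m]
  have ht := hasSum_interpSum (r := r) hc (hasSum_entry hu1 v w) hG hrG m
  exact (hasSum_mul_of_real (hasSum_head hu1 m) ht).mul_left _

lemma summable_coeff_mul_index {r u v w : ℝ} {c : ℕ → ℝ} (hc : ∀ m, 0 ≤ c m)
    (hc1 : ∀ m, c m ≤ 1) (hu : |u| < 1 / (6 * (1 + |r|))) (hv : |v| < 1 / (6 * (1 + |r|)))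
    (hw : |w| < 1 / (6 * (1 + |r|))) {z : ℝ} (hz : 0 < z) (hz1 : z < 1) :
    Summable (fun p : ℕ × (ℕ × List ℕ) =>
      z ^ p.1 * c p.1 * ((u ^ p.2.1 * ((p.1 : ℝ) ^ (p.2.1 + 2))⁻¹) *
      interpSum c r (fun y l => entryWeight u v w y * ((l : ℝ) ^ y)⁻¹) p.2.2 p.1)) := by
  have hw' : ∀ y l : ℕ, 0 ≤ entryWeight |u| |v| w y * ((l : ℝ) ^ y)⁻¹ := fun y l => by
    rw [← abs_entryWeight_mul]
    exact abs_nonneg _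
  have hbound : Summable (fun p : ℕ × (ℕ × List ℕ) =>
      z ^ p.1 * c p.1 * ((|u| ^ p.2.1 * ((p.1 : ℝ) ^ (p.2.1 + 2))⁻¹) *
      interpSum c |r| (fun y l => entryWeight |u| |v| w y * ((l : ℝ) ^ y)⁻¹) p.2.2 p.1)) := by
    have hrow := fun m : ℕ =>
      hasSum_coeff_mul_index (r := |r|) (u := |u|) (v := |v|) (w := w) hc
        (by rwa [abs_abs, abs_abs]) (by rwa [abs_abs, abs_abs]) (by rwa [abs_abs]) (z ^ m) m
    refine (hasSum_prod_of_nonneg (fun p => ?_) hrow ?_).summable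
    · have := hc p.1
      have := interpSum_nonneg hc (abs_nonneg r) (fun y l => hw' y l) p.2.2 p.1
      positivity
    · have h1 : Summable fun m : ℕ => (m : ℝ) ^ 1 * z ^ m :=
        summable_pow_mul_geometric_of_norm_lt_one 1 (by rwa [Real.norm_of_nonneg hz.le])
      have h2 : Summable fun m : ℕ => z ^ m := summable_geometric_of_lt_one hz.le hz1
      refine Summable.of_nonneg_of_le (fun m => ?_) (fun m => ?_) ((h1.add h2).mul_left 4)
      all_goals
        have hb := blockProd_entrySum_le hc hc1 (abs_nonneg r) (abs_nonneg u) (abs_nonneg v)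
          hu hv hw m
        have hb0 : 0 ≤ blockProd c |r| (entrySum |u| |v| w) m :=
          blockProd_nonneg hc
            (fun m => (hasSum_entry (u := |u|) (by
              rw [abs_abs]
              have : 1 / (6 * (1 + |r|)) ≤ 1 / 6 :=
                one_div_le_one_div_of_le (by norm_num) (by linarith [abs_nonneg r])
              linarith) |v| w m).nonneg fun y => hw' y m)
            (fun m => by
              linarith [mul_entrySum_le_half (abs_nonneg r) (abs_nonneg u) (abs_nonneg v)
                hu hv hw m]) m
        have hh : 0 ≤ 1 / ((m : ℝ) * (m - |u|)) ∧ 1 / ((m : ℝ) * (m - |u|)) ≤ 2 := by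
          rcases m.eq_zero_or_pos with rfl | hm
          · simp
          · have hm' : (1 : ℝ) ≤ m := by exact_mod_cast hm
            have : 1 / (6 * (1 + |r|)) ≤ 1 / 6 :=
              one_div_le_one_div_of_le (by norm_num) (by linarith [abs_nonneg r])
            have h : 1 / 2 ≤ (m : ℝ) * (m - |u|) := by nlinarith
            exact ⟨by positivity, by
              rw [div_le_iff₀ (by linarith)]
              linarith⟩
        have := hc m
      · exact mul_nonneg (by positivity) (mul_nonneg hh.1 hb0)
      · calc _ ≤ z ^ m * 1 * (2 * (2 * (m + 1))) := by
              have := hc1 m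
              have := mul_nonneg hh.1 hb0
              exact mul_le_mul (by gcongr) (mul_le_mul hh.2 hb hb0 (by norm_num)) this
                (by positivity)
          _ = _ := by ring
  refine Summable.of_norm_bounded hbound fun p => ?_
  have := hc p.1
  rw [Real.norm_eq_abs, abs_mul, abs_of_nonneg (a := z ^ p.1 * c p.1) (by positivity),
    abs_mul, abs_mul, abs_pow, abs_of_nonneg (a := ((p.1 : ℝ) ^ (p.2.1 + 2))⁻¹) (by positivity)]
  gcongr
  refine (abs_interpSum_le r _ hc p.2.2 p.1).trans_eq ?_
  simp only [abs_entryWeight_mul]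

lemma hasSum_index (N a : ℕ) {r u v w : ℝ}
    (hu : |u| < 1 / (6 * (1 + |r|))) (hv : |v| < 1 / (6 * (1 + |r|)))
    (hw : |w| < 1 / (6 * (1 + |r|))) {z : ℝ} (hz : 0 < z) (hz1 : z < 1) :
    HasSum (fun p : ℕ × List ℕ => iLv N a r ((p.1 + 2) :: p.2) z *
        (u ^ p.1 * (p.2.map (entryWeight u v w)).prod))
      (∑' m : ℕ, z ^ m * residueInd N a m *
        (1 / (m * (m - u)) * blockProd (residueInd N a) r (entrySum u v w) m)) := by
  have hs := summable_coeff_mul_index (residueInd_nonneg N a) (residueInd_le_one N a) hu hv hw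
    hz hz1
  have h1 := hs.hasSum.prod_fiberwise fun m =>
    hasSum_coeff_mul_index (residueInd_nonneg N a) hu hv hw (z ^ m) m
  rw [h1.tsum_eq]
  refine ((Equiv.prodComm _ _).hasSum_iff.2 hs.hasSum).prod_fiberwise fun p => ?_
  refine ((hasSum_iLv N a r (p.1 + 2) p.2 hz hz1).mul_right
    (u ^ p.1 * (p.2.map (entryWeight u v w)).prod)).of_eq (fun m => ?_) rfl
  simp only [Function.comp_apply, Equiv.prodComm_apply, Prod.swap_prod_mk]
  rw [← interpSum_mul_prod]
  ring

/-- The contribution of an index to the generating function; it vanishes unless the index is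
admissible. -/
noncomputable def indexTerm (N a : ℕ) (r u v w z : ℝ) : List ℕ → ℝ
  | (x + 2) :: t => iLv N a r ((x + 2) :: t) z * (u ^ x * (t.map (entryWeight u v w)).prod)
  | _ => 0

lemma prod_entryWeight (u v w : ℝ) {t : List ℕ} (ht : ∀ y ∈ t, 1 ≤ y) :
    ∃ d e, t.sum = t.length + height t + d ∧ t.length = height t + e ∧
      (t.map (entryWeight u v w)).prod = u ^ d * v ^ e * w ^ (2 * height t) := by
  induction t with
  | nil => exact ⟨0, 0, by simp [height]⟩
  | cons y t ih =>
    obtain ⟨d, e, h1, h2, h3⟩ := ih fun x hx => ht x (by simp [hx])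
    have hy := ht y (by simp)
    match y, hy with
    | 1, _ =>
      refine ⟨d, e + 1, ?_⟩
      have hh : height (1 :: t) = height t := by simp [height]
      simp only [List.sum_cons, List.length_cons, hh, List.map_cons, List.prod_cons, h3,
        entryWeight]
      exact ⟨by omega, by omega, by ring⟩
    | y + 2, _ =>
      refine ⟨d + y, e, ?_⟩
      have hh : height ((y + 2) :: t) = height t + 1 := by simp [height]
      simp only [List.sum_cons, List.length_cons, hh, List.map_cons, List.prod_cons, h3,
        entryWeight]
      exact ⟨by omega, by omega, by ring⟩

lemma indexTerm_of_not_isAdmissible (N a : ℕ) (r u v w z : ℝ) {l : List ℕ}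
    (hl : ¬ IsAdmissible l) : indexTerm N a r u v w z l = 0 := by
  unfold indexTerm
  split
  · rename_i x t
    have : ∃ y ∈ t, y = 0 := by
      by_contra! h
      refine hl ⟨fun i hi => ?_, by simp⟩
      rcases List.mem_cons.1 hi with rfl | hi
      · omega
      · exact Nat.one_le_iff_ne_zero.2 (h i hi)
    obtain ⟨y, hy, rfl⟩ := this
    rw [List.prod_eq_zero (List.mem_map.2 ⟨0, hy, rfl⟩), mul_zero, mul_zero]
  · rfl

lemma indexTerm_of_isAdmissible (N a : ℕ) (r u v w z : ℝ) {l : List ℕ} (hl : IsAdmissible l) :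
    (l.length + height l ≤ l.sum ∧ height l ≤ l.length ∧ 1 ≤ height l) ∧
      indexTerm N a r u v w z l = iLv N a r l z * u ^ (l.sum - l.length - height l) *
        v ^ (l.length - height l) * w ^ (2 * height l - 2) := by
  obtain ⟨h1, h2⟩ := hl
  match l, h1, h2 with
  | [], _, h2 => simp at h2
  | 0 :: t, _, h2 => simp at h2
  | 1 :: t, _, h2 => simp at h2
  | (x + 2) :: t, h1, _ =>
    obtain ⟨d, e, hd, he, hp⟩ := prod_entryWeight u v w (t := t) fun y hy => h1 y (by simp [hy])
    have hh : height ((x + 2) :: t) = height t + 1 := by simp [height]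
    simp only [indexTerm, hp, hh, List.sum_cons, List.length_cons]
    refine ⟨⟨by omega, by omega, by omega⟩, ?_⟩
    have e1 : x + 2 + t.sum - (t.length + 1) - (height t + 1) = x + d := by omega
    have e2 : t.length + 1 - (height t + 1) = e := by omega
    have e3 : 2 * (height t + 1) - 2 = 2 * height t := by omega
    rw [e1, e2, e3]
    ring

lemma Phi0_eq_of_hasSum (N a : ℕ) {r u v w z S : ℝ}
    (h : HasSum (fun p : ℕ × List ℕ => iLv N a r ((p.1 + 2) :: p.2) z *
        (u ^ p.1 * (p.2.map (entryWeight u v w)).prod)) S) :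
    Phi0 N a r u v w z = S := by
  classical
  have hinj : Function.Injective fun p : ℕ × List ℕ => (p.1 + 2) :: p.2 := by
    rintro ⟨x, t⟩ ⟨y, t'⟩ h
    simpa using h
  have hs : HasSum (indexTerm N a r u v w z) S := by
    refine (hinj.hasSum_iff fun l hl => ?_).1 h
    unfold indexTerm
    split
    · rename_i x t
      exact absurd ⟨(x, t), rfl⟩ hl
    · rfl
  refine (Eq.trans ?_ (hs.tsum_fiberwise fun l => (l.sum, l.length, height l)).tsum_eq)
  refine tsum_congr fun p => ?_
  obtain ⟨k, n, s⟩ := p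
  rw [tsum_subtype]
  have hpt : ∀ l : List ℕ,
      ((fun l : List ℕ => (l.sum, l.length, height l)) ⁻¹' {(k, n, s)}).indicator
        (indexTerm N a r u v w z) l =
      if n + s ≤ k ∧ s ≤ n ∧ 1 ≤ s then
        {l : List ℕ | IsAdmissible l ∧ l.sum = k ∧ l.length = n ∧ height l = s}.indicator
          (fun l => iLv N a r l z) l * u ^ (k - n - s) * v ^ (n - s) * w ^ (2 * s - 2)
      else 0 := by
    intro l
    simp only [Set.indicator_apply, Set.mem_preimage, Set.mem_singleton_iff, Prod.mk.injEq,
      Set.mem_ofPred_eq]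
    by_cases hl : IsAdmissible l
    · obtain ⟨h1, h2⟩ := indexTerm_of_isAdmissible N a r u v w z hl
      by_cases hk : l.sum = k ∧ l.length = n ∧ height l = s
      · obtain ⟨rfl, rfl, rfl⟩ := hk
        simp [hl, h1, h2]
      · simp [hk]
    · simp [hl, indexTerm_of_not_isAdmissible N a r u v w z hl]
  rw [tsum_congr hpt]
  split_ifs
  · rw [tsum_mul_right, tsum_mul_right, tsum_mul_right, ← tsum_subtype]
    rfl
  · simp

lemma residueInd_eq_zero_of_notMem_range {N a m : ℕ} (hN : 1 ≤ N) (ha : a ≤ N)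
    (hm : m ∉ Set.range fun i => a + N * i) : residueInd N a m = 0 := by
  refine if_neg fun ⟨h0, h1⟩ => hm ?_
  have hle : a ≤ m := by
    rcases ha.eq_or_lt with rfl | h
    · rw [Nat.mod_self] at h1
      exact Nat.le_of_dvd h0 (Nat.dvd_of_mod_eq_zero h1)
    · rw [Nat.mod_eq_of_lt h] at h1
      exact h1 ▸ Nat.mod_le m N
  obtain ⟨i, hi⟩ := (Nat.modEq_iff_dvd' hle).1 h1.symm
  exact ⟨i, by simp only; omega⟩

lemma residueInd_add_mul {N a : ℕ} (ha : 1 ≤ a) (i : ℕ) : residueInd N a (a + N * i) = 1 :=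
  if_pos ⟨by omega, by simp⟩

lemma injective_add_mul {N : ℕ} (a : ℕ) (hN : 1 ≤ N) : Function.Injective fun i => a + N * i :=
  fun _ _ h => Nat.eq_of_mul_eq_mul_left hN (Nat.add_left_cancel h)

lemma prod_range_residueInd {N a : ℕ} (hN : 1 ≤ N) (ha1 : 1 ≤ a) (ha : a ≤ N) (φ : ℕ → ℝ)
    (i : ℕ) :
    ∏ l ∈ Finset.range (a + N * i), (1 + residueInd N a l * φ l) =
      ∏ j ∈ Finset.range i, (1 + φ (a + N * j)) := by
  have himg : ∏ j ∈ Finset.range i, (1 + φ (a + N * j)) =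
      ∏ l ∈ (Finset.range i).image fun j => a + N * j, (1 + residueInd N a l * φ l) := by
    rw [Finset.prod_image fun _ _ _ _ h => injective_add_mul a hN h]
    simp only [residueInd_add_mul ha1, one_mul]
  rw [himg]
  refine (Finset.prod_subset (fun l hl => ?_) fun l hl hl' => ?_).symm
  · obtain ⟨j, hj, rfl⟩ := Finset.mem_image.1 hl
    have := Nat.mul_lt_mul_of_pos_left (Finset.mem_range.1 hj) hN
    exact Finset.mem_range.2 (by omega)
  · rw [residueInd_eq_zero_of_notMem_range hN ha, zero_mul, add_zero]
    rintro ⟨j, rfl⟩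
    refine hl' (Finset.mem_image.2 ⟨j, Finset.mem_range.2 ?_, rfl⟩)
    simp only [Finset.mem_range] at hl
    exact Nat.lt_of_mul_lt_mul_left (a := N) (by omega)

lemma tsum_residueInd {N a : ℕ} (hN : 1 ≤ N) (ha1 : 1 ≤ a) (ha : a ≤ N) (r u v w z : ℝ) :
    ∑' m : ℕ, z ^ m * residueInd N a m *
        (1 / (m * (m - u)) * blockProd (residueInd N a) r (entrySum u v w) m) =
      ∑' i : ℕ, z ^ (a + N * i) *
        (1 / (((a + N * i : ℕ) : ℝ) * ((a + N * i : ℕ) - u)) *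
          ((∏ j ∈ Finset.range i, (1 + entrySum u v w (a + N * j) /
            (1 - r * entrySum u v w (a + N * j)))) / (1 - r * entrySum u v w (a + N * i)))) := by
  rw [← (injective_add_mul a hN).tsum_eq]
  · refine tsum_congr fun i => ?_
    rw [residueInd_add_mul ha1, mul_one, blockProd,
      prod_range_residueInd hN ha1 ha fun l => entrySum u v w l / (1 - r * entrySum u v w l)]
  · intro m hm
    by_contra h
    exact hm (by simp only [residueInd_eq_zero_of_notMem_range hN ha h, mul_zero, zero_mul])

lemma poch_succ (b : ℂ) (n : ℕ) : poch b (n + 1) = poch b n * (b + n) := by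
  simp [poch, Finset.prod_range_succ]

lemma prod_div_eq_hypergeometric_coeff {N : ℕ} (hN : 1 ≤ N) (a : ℕ) (α₁ α₂ β₁ β₂ : ℂ) (i : ℕ) :
    (∏ j ∈ Finset.range i, ((a : ℂ) + N * j + β₁) * ((a : ℂ) + N * j + β₂) /
      (((a : ℂ) + N * j - α₁) * ((a : ℂ) + N * j - α₂))) /
        (((a : ℂ) + N * i - α₁) * ((a : ℂ) + N * i - α₂)) =
      1 / (((a : ℂ) - α₁) * ((a : ℂ) - α₂)) *
        (poch (((a : ℂ) + β₁) / N) i * (poch (((a : ℂ) + β₂) / N) i * poch 1 i) /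
          (poch (((a : ℂ) - α₁) / N + 1) i * poch (((a : ℂ) - α₂) / N + 1) i) /
            (i.factorial : ℂ)) := by
  have hN0 : (N : ℂ) ≠ 0 := by exact_mod_cast (by omega : N ≠ 0)
  have hN2 : ∀ A B C D : ℂ, A / N * (B / N) / (C / N * (D / N)) = A * B / (C * D) :=
    fun A B C D => by
      rw [div_mul_div_comm, div_mul_div_comm, div_div_div_cancel_right₀ (mul_ne_zero hN0 hN0)]
  induction i with
  | zero => simp [poch]
  | succ i ih =>
    have h3 : (i : ℂ) + 1 ≠ 0 := by exact_mod_cast i.succ_ne_zero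
    have eb : ∀ β : ℂ, ((a : ℂ) + β) / N + i = ((a : ℂ) + N * i + β) / N := fun β => by
      field_simp; ring
    have ec : ∀ α : ℂ, ((a : ℂ) - α) / N + 1 + i = ((a : ℂ) + N * (i + 1 : ℕ) - α) / N :=
      fun α => by push_cast; field_simp; ring
    rw [Finset.prod_range_succ, Nat.factorial_succ]
    simp only [poch_succ, eb, ec]
    calc _ = (∏ j ∈ Finset.range i, ((a : ℂ) + N * j + β₁) * ((a : ℂ) + N * j + β₂) /
          (((a : ℂ) + N * j - α₁) * ((a : ℂ) + N * j - α₂))) /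
            (((a : ℂ) + N * i - α₁) * ((a : ℂ) + N * i - α₂)) *
          (((a : ℂ) + N * i + β₁) * ((a : ℂ) + N * i + β₂) /
            (((a : ℂ) + N * (i + 1 : ℕ) - α₁) * ((a : ℂ) + N * (i + 1 : ℕ) - α₂))) := by ring
      _ = 1 / (((a : ℂ) - α₁) * ((a : ℂ) - α₂)) *
        (poch (((a : ℂ) + β₁) / N) i * (poch (((a : ℂ) + β₂) / N) i * poch 1 i) /
          (poch (((a : ℂ) - α₁) / N + 1) i * poch (((a : ℂ) - α₂) / N + 1) i) /
            (i.factorial : ℂ)) *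
          ((((a : ℂ) + N * i + β₁) / N) * (((a : ℂ) + N * i + β₂) / N) /
            ((((a : ℂ) + N * (i + 1 : ℕ) - α₁) / N) *
              (((a : ℂ) + N * (i + 1 : ℕ) - α₂) / N)) * ((1 + i) / (i + 1))) := by
          rw [ih, add_comm (1 : ℂ) i, div_self h3, mul_one, hN2]
      _ = _ := by
          push_cast
          simp only [div_eq_mul_inv, mul_inv]
          ring

/-- The factorizations of the block generating functions at the summation point `m`. -/
lemma factor_entrySum {r u v w : ℝ} {m : ℕ} (hm : (m : ℝ) * (m - u) ≠ 0)
    (hr : 1 - r * entrySum u v w m ≠ 0) {α₁ α₂ β₁ β₂ : ℂ}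
    (hα : α₁ + α₂ = (u : ℂ) + v * r) (hα' : α₁ * α₂ = (r : ℂ) * (u * v - w ^ 2))
    (hβ : β₁ + β₂ = -(u : ℂ) + v * (1 - r)) (hβ' : β₁ * β₂ = ((r : ℂ) - 1) * (u * v - w ^ 2)) :
    ((m : ℂ) - α₁) * (m - α₂) ≠ 0 ∧
      ((m * (m - u) * (1 - r * entrySum u v w m) : ℝ) : ℂ) = (m - α₁) * (m - α₂) ∧
      ((1 + entrySum u v w m / (1 - r * entrySum u v w m) : ℝ) : ℂ) =
        (m + β₁) * (m + β₂) / ((m - α₁) * (m - α₂)) := by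
  have hg : m * (m - u) * entrySum u v w m = v * (m - u) + w ^ 2 := by
    have := mul_ne_zero_iff.1 hm
    have h1 := this.1
    have h2 := this.2
    unfold entrySum
    field_simp
  have e1 : ((m * (m - u) * (1 - r * entrySum u v w m) : ℝ) : ℂ) = (m - α₁) * (m - α₂) := by
    have : m * (m - u) * (1 - r * entrySum u v w m) =
        (m : ℝ) ^ 2 - (u + v * r) * m + r * (u * v - w ^ 2) := by linear_combination -r * hg
    rw [this]
    push_cast
    linear_combination (m : ℂ) * hα - hα'
  have e2 : ((m * (m - u) * (1 + (1 - r) * entrySum u v w m) : ℝ) : ℂ) =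
      (m + β₁) * (m + β₂) := by
    have : m * (m - u) * (1 + (1 - r) * entrySum u v w m) =
        (m : ℝ) ^ 2 + (-u + v * (1 - r)) * m + (r - 1) * (u * v - w ^ 2) := by
      linear_combination (1 - r) * hg
    rw [this]
    push_cast
    linear_combination -(m : ℂ) * hβ - hβ'
  refine ⟨?_, e1, ?_⟩
  · rw [← e1, Complex.ofReal_ne_zero]
    exact mul_ne_zero hm hr
  · rw [← e1, ← e2, ← Complex.ofReal_div]
    congr 1
    rw [mul_div_mul_left _ _ hm, eq_div_iff hr, add_mul, div_mul_cancel₀ _ hr]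
    ring

/-- Theorem 2.3: closed form of the generating function `Φ₀^r(u,v,w;z)` as a `₃F₂`
evaluated at `z^N`. -/
theorem stmt2 (N : ℕ) (hN : 1 ≤ N) (a : ℕ) (ha1 : 1 ≤ a) (ha2 : a ≤ N) (r : ℝ) :
    ∃ ε > (0 : ℝ), ∀ u v w : ℝ, |u| < ε → |v| < ε → |w| < ε →
      ∀ α₁ α₂ β₁ β₂ : ℂ,
        α₁ + α₂ = (u : ℂ) + v * r →
        α₁ * α₂ = (r : ℂ) * (u * v - w ^ 2) →
        β₁ + β₂ = -(u : ℂ) + v * (1 - r) →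
        β₁ * β₂ = ((r : ℂ) - 1) * (u * v - w ^ 2) →
        ∀ z : ℝ, 0 < z → z < 1 →
          (Phi0 N a r u v w z : ℂ) =
            (z : ℂ) ^ a / (((a : ℂ) - α₁) * ((a : ℂ) - α₂)) *
              genHyp [((a : ℂ) + β₁) / N, ((a : ℂ) + β₂) / N, 1]
                [((a : ℂ) - α₁) / N + 1, ((a : ℂ) - α₂) / N + 1] ((z : ℂ) ^ N) := by
  refine ⟨1 / (6 * (1 + |r|)), by positivity, ?_⟩
  intro u v w hu hv hw α₁ α₂ β₁ β₂ hα hα' hβ hβ' z hz hz1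
  have he : 1 / (6 * (1 + |r|)) ≤ 1 / 6 :=
    one_div_le_one_div_of_le (by norm_num) (by linarith [abs_nonneg r])
  have hfac : ∀ i : ℕ, _ := fun i => by
    have hm : (1 : ℝ) ≤ (a + N * i : ℕ) := by exact_mod_cast (by omega : 1 ≤ a + N * i)
    have hu' := le_abs_self u
    refine factor_entrySum (r := r) (u := u) (v := v) (w := w) (m := a + N * i)
      (mul_ne_zero (by linarith) (by linarith)) ?_ hα hα' hβ hβ'
    have h1 : |entrySum u v w (a + N * i)| ≤ entrySum |u| |v| w (a + N * i) := by
      have hs := hasSum_entry (u := |u|) (by rw [abs_abs]; linarith) |v| w (a + N * i)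
      have hs' := hasSum_entry (u := u) (by linarith) v w (a + N * i)
      simp only [← abs_entryWeight_mul] at hs
      rw [← hs.tsum_eq, ← hs'.tsum_eq]
      exact norm_tsum_le_tsum_norm
        (f := fun y => entryWeight u v w y * (((a + N * i : ℕ) : ℝ) ^ y)⁻¹) hs.summable
    have h2 : r * entrySum u v w (a + N * i) ≤ |r| * entrySum |u| |v| w (a + N * i) :=
      (le_abs_self _).trans ((abs_mul _ _).le.trans (by gcongr))
    have h3 := mul_entrySum_le_half (abs_nonneg r) (abs_nonneg u) (abs_nonneg v) hu hv hw
      (a + N * i)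
    linarith
  rw [Phi0_eq_of_hasSum N a (hasSum_index N a hu hv hw hz hz1),
    tsum_residueInd hN ha1 ha2, Complex.ofReal_tsum, genHyp, ← tsum_mul_left]
  refine tsum_congr fun i => ?_
  have hcoeff := prod_div_eq_hypergeometric_coeff hN a α₁ α₂ β₁ β₂ i
  have hprod : ((∏ j ∈ Finset.range i, (1 + entrySum u v w (a + N * j) /
      (1 - r * entrySum u v w (a + N * j))) : ℝ) : ℂ) =
      ∏ j ∈ Finset.range i, ((a : ℂ) + N * j + β₁) * ((a : ℂ) + N * j + β₂) /
        (((a : ℂ) + N * j - α₁) * ((a : ℂ) + N * j - α₂)) := by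
    rw [Complex.ofReal_prod]
    refine Finset.prod_congr rfl fun j _ => ?_
    rw [(hfac j).2.2]
    push_cast
    rfl
  rw [one_div_mul_eq_div, div_div, mul_comm (1 - r * _), Complex.ofReal_mul, Complex.ofReal_div,
    (hfac i).2.1, hprod]
  push_cast
  rw [hcoeff]
  simp only [List.map_cons, List.map_nil, List.prod_cons, List.prod_nil, mul_one]
  rw [pow_add, pow_mul]
  ring
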